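/- arXiv:1404.2574 — 4 statements merged into one kernel-verified Lean document; each statement's English description precedes it below -/
import Mathlib

section
/- Let $r > 2$, $t \geq 1$, $m \geq 1$ and let $a = (a_1,\ldots,a_m) \in \mathbb{Z}^m$ be hereditarily good mod $r$. Set $q = r^2 t$ and $\omega = \exp(2\pi i/q)$. Then for all $x, y \in \mathbb{C}$ with $x^q \neq 1$, $$\sum_{k=0}^{q-1} \prod_{i=1}^{m} \frac{(y - \omega^{k(rt a_i+1)})(y - \omega^{-k(rt a_i+1)})}{(x - \omega^{k(rt a_i+1)})(x - \omega^{-k(rt a_i+1)})} = \sum_{k=0}^{q-1} \prod_{i=1}^{m} \frac{(y - \omega^{k(-rt a_i+1)})(y - \omega^{-k(-rt a_i+1)})}{(x - \omega^{k(-rt a_i+1)})(x - \omega^{-k(-rt a_i+1)})}.$$ (This says that the cyclic groups $\mathrm{LMR}(r,t,a)$ and $\mathrm{LMR}(r,t,-a)$ are Hodge-equivalent.) -/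
/-- `a` is univalent mod `d`: its entries are pairwise distinct mod `d`. -/
def UnivalentMod (d : ℕ) {m : ℕ} (a : Fin m → ℤ) : Prop :=
  Function.Injective fun i : Fin m => ((a i : ZMod d))

/-- `a` is reversible mod `d`: for some `c`, the multiset of residues of the `aᵢ + c`
mod `d` equals the multiset of residues of the `-aᵢ` mod `d`. -/
def ReversibleMod (d : ℕ) {m : ℕ} (a : Fin m → ℤ) : Prop :=
  ∃ c : ℤ, Multiset.map (fun i : Fin m => ((a i + c : ℤ) : ZMod d)) Finset.univ.val
    = Multiset.map (fun i : Fin m => ((-a i : ℤ) : ZMod d)) Finset.univ.val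

/-- `a` is good mod `d`: univalent or reversible mod `d`. -/
def GoodMod (d : ℕ) {m : ℕ} (a : Fin m → ℤ) : Prop :=
  UnivalentMod d a ∨ ReversibleMod d a

/-- `a` is hereditarily good mod `r`: good mod every positive divisor `d` of `r`. -/
def HereditarilyGoodMod (r : ℕ) {m : ℕ} (a : Fin m → ℤ) : Prop :=
  ∀ d : ℕ, 0 < d → d ∣ r → GoodMod d a

/-- The Hodge series sum `H_{q,š}(x,y)` of the cyclic group `L(q, š)`, where
`š = (s₁, -s₁, …, s_m, -s_m)` is the doubled exponent list:
`∑_{k<q} ∏ i, ((y - ω^{k sᵢ})(y - ω^{-k sᵢ})) / ((x - ω^{k sᵢ})(x - ω^{-k sᵢ}))`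
with `ω = exp(2πi/q)`. -/
noncomputable def hodgeSum (q : ℕ) {m : ℕ} (s : Fin m → ℤ) (x y : ℂ) : ℂ :=
  ∑ k ∈ Finset.range q, ∏ i : Fin m,
    ((y - Complex.exp (2 * Real.pi * Complex.I / q) ^ ((k : ℤ) * s i))
      * (y - Complex.exp (2 * Real.pi * Complex.I / q) ^ (-((k : ℤ) * s i))))
    / ((x - Complex.exp (2 * Real.pi * Complex.I / q) ^ ((k : ℤ) * s i))
      * (x - Complex.exp (2 * Real.pi * Complex.I / q) ^ (-((k : ℤ) * s i))))

/-- The contribution `((y - z)(y - z⁻¹)) / ((x - z)(x - z⁻¹))` of a pair of inverse eigenvalues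
`z, z⁻¹` to the Hodge series. -/
noncomputable def hodgeFactor (x y z : ℂ) : ℂ :=
  ((y - z) * (y - z⁻¹)) / ((x - z) * (x - z⁻¹))

theorem hodgeFactor_inv (x y z : ℂ) : hodgeFactor x y z⁻¹ = hodgeFactor x y z := by
  rw [hodgeFactor, hodgeFactor, inv_inv, mul_comm (y - z⁻¹), mul_comm (x - z⁻¹)]

open Polynomial in
theorem sum_eq_sum_inv {d : ℕ} [NeZero d] {η : ℂ} (hη : IsPrimitiveRoot η d)
    (A B : ZMod d → ℂ) {u : ℂ} (hu : u ≠ 0) (e : AddChar (ZMod d) ℂ) (he : e 1 = η) :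
    ∑ c, ∏ j, (A j + B j * (u * e (c + j) + (u * e (c + j))⁻¹)) =
    ∑ c, ∏ j, (A j + B j * (u⁻¹ * e (c + j) + (u⁻¹ * e (c + j))⁻¹)) := by
  set P : ℂ[X] := ∏ j, (C (B j * e j) * X ^ 2 + C (A j) * X + C (B j * e (-j))) with hP
  have he0 (c) : e c ≠ 0 := by
    intro h
    have := e.map_add_eq_mul c (-c)
    simp [h] at this
  have hdeg : ∀ j ∈ (Finset.univ : Finset (ZMod d)),
      (C (B j * e j) * X ^ 2 + C (A j) * X + C (B j * e (-j)) : ℂ[X]).natDegree ≤ 2 :=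
    fun j _ => natDegree_quadratic_le
  have hcard : (Finset.univ : Finset (ZMod d)).card = d := by simp [ZMod.card]
  have hPdeg : P.natDegree < 2 * d + 1 := by
    have := (natDegree_prod_le Finset.univ
      (fun j => C (B j * e j) * X ^ 2 + C (A j) * X + C (B j * e (-j)))).trans
      (Finset.sum_le_card_nsmul _ _ 2 hdeg)
    rw [hcard, smul_eq_mul, ← hP] at this
    omega
  have hP2 : P.coeff (2 * d) = P.coeff 0 := by
    have h := coeff_prod_of_natDegree_le Finset.univ
      (fun j => C (B j * e j) * X ^ 2 + C (A j) * X + C (B j * e (-j))) 2 hdeg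
    rw [hcard, mul_comm] at h
    rw [h, hP, coeff_zero_prod]
    have h2 (b c d : ℂ) : (C b * X ^ 2 + C c * X + C d).coeff 2 = b := by
      simp
    have h0 (b c d : ℂ) : (C b * X ^ 2 + C c * X + C d).coeff 0 = d := by
      simp
    simp only [h2, h0, Finset.prod_mul_distrib]
    congr 1
    exact (Equiv.prod_comp (Equiv.neg (ZMod d)) (fun j => e j)).symm
  have hed (c : ZMod d) : e c ^ d = 1 := by
    rw [← e.map_nsmul_eq_pow]; simp
  have hs (n : ℕ) (hn : ¬ d ∣ n) : ∑ c, e c ^ n = 0 := by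
    have := AddChar.sum_eq_zero_of_ne_one (ψ := e ^ n) (by
      intro h
      have h1 := DFunLike.congr_fun h 1
      rw [AddChar.pow_apply, he, AddChar.one_apply] at h1
      exact hn (hη.dvd_of_pow_eq_one _ h1))
    simpa using this
  have key (v : ℂ) (hv : v ≠ 0) :
      ∑ c, ∏ j, (A j + B j * (v * e (c + j) + (v * e (c + j))⁻¹)) =
      ∑ n ∈ Finset.range (2 * d + 1), P.coeff n * (v ^ n * (v ^ d)⁻¹) * ∑ c, e c ^ n := by
    simp_rw [Finset.mul_sum]
    rw [Finset.sum_comm]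
    refine Finset.sum_congr rfl fun c _ => ?_
    have h1 : P.eval (v * e c) =
        v ^ d * ∏ j, (A j + B j * (v * e (c + j) + (v * e (c + j))⁻¹)) := by
      have : v ^ d = ∏ j : ZMod d, (v * e c) := by
        simp [mul_pow, hed, ZMod.card]
      rw [this, ← Finset.prod_mul_distrib, hP, eval_prod]
      refine Finset.prod_congr rfl fun j _ => ?_
      have := he0 c
      have := he0 j
      simp only [eval_add, eval_mul, eval_C, eval_X, eval_pow, e.map_add_eq_mul,
        e.map_neg_eq_inv]
      field_simp
      ring
    rw [eval_eq_sum_range' hPdeg] at h1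
    have hvd := pow_ne_zero d hv
    apply mul_left_cancel₀ hvd
    rw [← h1, Finset.mul_sum]
    refine Finset.sum_congr rfl fun n _ => ?_
    field_simp
    ring
  rw [key u hu, key _ (inv_ne_zero hu), ← Finset.sum_flip]
  refine Finset.sum_congr rfl fun n hn => ?_
  have hn' : n ≤ 2 * d := by simpa [Nat.lt_succ_iff] using hn
  have hpow : u ^ (2 * d - n) * (u ^ d)⁻¹ = u⁻¹ ^ n * (u⁻¹ ^ d)⁻¹ := by
    rw [pow_sub₀ _ hu hn', two_mul, pow_add, inv_pow, inv_pow]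
    field_simp
  rw [hpow]
  by_cases hdn : d ∣ n
  · have hone (k : ℕ) (hk : d ∣ k) (c) : e c ^ k = 1 := by
      obtain ⟨l, rfl⟩ := hk
      rw [pow_mul, hed, one_pow]
    have hco : P.coeff (2 * d - n) = P.coeff n := by
      obtain ⟨l, rfl⟩ := hdn
      have hd : 0 < d := NeZero.pos d
      have : l ≤ 2 := by
        by_contra! h
        nlinarith
      interval_cases l
      · simpa using hP2
      · congr 1; omega
      · rw [mul_comm d 2, hP2]; simp
    simp_rw [hone n hdn, hone _ (Nat.dvd_sub (Dvd.intro_left 2 rfl) hdn), hco]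
  · rw [hs n hdn, hs]
    · simp
    · intro h
      exact hdn ((Nat.dvd_sub_iff_right hn' (Dvd.intro_left 2 rfl)).1 h)

theorem AddChar.sum_prod_add_eq_sum_prod_sub_of_injective {d : ℕ} [NeZero d]
    (e : AddChar (ZMod d) ℂ) (he : IsPrimitiveRoot (e 1) d) {m : ℕ} {a : Fin m → ZMod d}
    (ha : Function.Injective a) {u x : ℂ} (hu : u ≠ 0)
    (hx : ∀ j, x ≠ u * e j) (hx' : ∀ j, x ≠ (u * e j)⁻¹) (y : ℂ) :
    ∑ c, ∏ i, hodgeFactor x y (u * e (c + a i)) =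
      ∑ c, ∏ i, hodgeFactor x y (u * e (c - a i)) := by
  classical
  have he0 (c) : e c ≠ 0 := by
    intro h
    have := e.map_add_eq_mul c (-c)
    simp [h] at this
  set D : ℂ → ℂ := fun v => ∏ j, ((x - v * e j) * (x - (v * e j)⁻¹)) with hD
  have hinv (c) : (u * e c)⁻¹ = u⁻¹ * e (-c) := by rw [e.map_neg_eq_inv, mul_inv]
  have hDinv : D u⁻¹ = D u := by
    simp only [hD]
    rw [← Equiv.prod_comp (Equiv.neg (ZMod d))]
    refine Finset.prod_congr rfl fun j _ => ?_
    rw [Equiv.neg_apply, ← hinv, inv_inv, mul_comm]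
  have hDu : D u ≠ 0 := Finset.prod_ne_zero_iff.2 fun j _ =>
    mul_ne_zero (sub_ne_zero.2 (hx j)) (sub_ne_zero.2 (hx' j))
  set A : ZMod d → ℂ := fun j => if j ∈ Finset.univ.image a then y ^ 2 + 1 else x ^ 2 + 1
  set B : ZMod d → ℂ := fun j => if j ∈ Finset.univ.image a then -y else -x
  have key (v : ℂ) (hv : v ≠ 0) (hDv : D v ≠ 0) (c : ZMod d) :
      ∏ i, hodgeFactor x y (v * e (c + a i)) =
        (∏ j, (A j + B j * (v * e (c + j) + (v * e (c + j))⁻¹))) / D v := by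
    have hDc : D v = ∏ j, ((x - v * e (c + j)) * (x - (v * e (c + j))⁻¹)) :=
      (Equiv.prod_comp (Equiv.addLeft c) _).symm
    rw [hDc] at hDv ⊢
    rw [← Finset.prod_div_distrib, ← Finset.prod_image (s := Finset.univ) (g := a)
      (f := fun j => hodgeFactor x y (v * e (c + j))) ha.injOn]
    rw [← Finset.univ_inter (Finset.univ.image a), ← Finset.prod_ite_mem]
    refine Finset.prod_congr rfl fun j _ => ?_
    have hz : v * e (c + j) ≠ 0 := mul_ne_zero hv (he0 _)
    have hj := Finset.prod_ne_zero_iff.1 hDv j (Finset.mem_univ j)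
    have hq (w z : ℂ) (hz : z ≠ 0) : w ^ 2 + 1 + -w * (z + z⁻¹) = (w - z) * (w - z⁻¹) := by
      field_simp
      ring
    simp only [A, B]
    split_ifs
    · rw [hodgeFactor, hq _ _ hz]
    · rw [hq _ _ hz, div_self hj]
  have hsub (c i) : hodgeFactor x y (u * e (c - a i)) =
      hodgeFactor x y (u⁻¹ * e (-c + a i)) := by
    rw [← hodgeFactor_inv, hinv]
    congr 3
    ring
  simp_rw [hsub]
  refine Eq.trans ?_ (Equiv.sum_comp (Equiv.neg (ZMod d))
    (fun c => ∏ i, hodgeFactor x y (u⁻¹ * e (c + a i)))).symm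
  simp_rw [key u hu hDu, key _ (inv_ne_zero hu) (hDinv ▸ hDu), hDinv, ← Finset.sum_div]
  rw [sum_eq_sum_inv he A B hu e rfl]

theorem sum_prod_add_eq_sum_prod_sub_of_reversible {d : ℕ} [NeZero d] {m : ℕ} {a : Fin m → ℤ}
    (ha : ReversibleMod d a) (F : ZMod d → ℂ) :
    ∑ c, ∏ i, F (c + a i) = ∑ c, ∏ i, F (c - a i) := by
  obtain ⟨b, hb⟩ := ha
  rw [← Equiv.sum_comp (Equiv.addRight (b : ZMod d))]
  refine Finset.sum_congr rfl fun c _ => ?_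
  have h := congrArg (fun s => (s.map fun z => F (c + z)).prod) hb
  simp only [Multiset.map_map, Function.comp_def] at h
  convert h using 1
  · refine Finset.prod_congr rfl fun i _ => ?_
    simp only [Equiv.coe_addRight]
    push_cast
    congr 1
    ring
  · refine Finset.prod_congr rfl fun i _ => ?_
    push_cast
    rw [sub_eq_add_neg]

theorem sum_comp_eq_sum_comp_of_surjective {G H : Type*} [AddCommGroup G] [AddCommGroup H]
    [Fintype G] [Fintype H] (f : G →+ H) (hf : Function.Surjective f) {F F' : H → ℂ}
    (h : ∑ b, F b = ∑ b, F' b) : ∑ c, F (f c) = ∑ c, F' (f c) := by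
  have key (F : H → ℂ) :
      (Fintype.card H : ℂ) * ∑ c, F (f c) = (Fintype.card G : ℂ) * ∑ b, F b := by
    calc (Fintype.card H : ℂ) * ∑ c, F (f c) = ∑ b : H, ∑ c, F (f c + b) := by
          rw [← nsmul_eq_mul, ← Finset.card_univ, ← Finset.sum_const]
          refine Finset.sum_congr rfl fun b _ => ?_
          obtain ⟨b, rfl⟩ := hf b
          simp_rw [← map_add]
          exact (Equiv.sum_comp (Equiv.addRight b) (fun c => F (f c))).symm
      _ = ∑ c : G, ∑ b, F (f c + b) := Finset.sum_comm
      _ = _ := by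
          rw [← nsmul_eq_mul, ← Finset.card_univ, ← Finset.sum_const]
          exact Finset.sum_congr rfl fun c _ => Equiv.sum_comp (Equiv.addLeft (f c)) F
  have hH : (Fintype.card H : ℂ) ≠ 0 := Nat.cast_ne_zero.2 Fintype.card_ne_zero
  exact mul_left_cancel₀ hH (by rw [key, key, h])

theorem hodgeSum_eq_sum_stdAddChar (q : ℕ) [NeZero q] {m : ℕ} (s : Fin m → ℤ) (x y : ℂ) :
    hodgeSum q s x y =
      ∑ k : ZMod q, ∏ i, hodgeFactor x y (ZMod.stdAddChar (k * (s i : ZMod q))) := by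
  have hω (n : ℤ) : Complex.exp (2 * Real.pi * Complex.I / q) ^ n =
      ZMod.stdAddChar (n : ZMod q) := by
    rw [ZMod.stdAddChar_coe, ← Complex.exp_int_mul]
    congr 1
    ring
  rw [hodgeSum]
  refine Finset.sum_nbij' (fun k => (k : ZMod q)) ZMod.val (by simp)
    (fun k _ => Finset.mem_range.2 k.val_lt)
    (fun k hk => ZMod.val_cast_of_lt (Finset.mem_range.1 hk)) (by simp) fun k _ => ?_
  refine Finset.prod_congr rfl fun i _ => ?_
  rw [zpow_neg, hω, hodgeFactor]
  push_cast
  rfl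

theorem ZMod.natCast_mul_sq_eq_zero (r t : ℕ) : (r * t : ZMod (r ^ 2 * t)) ^ 2 = 0 := by
  have : ((r ^ 2 * t : ℕ) : ZMod (r ^ 2 * t)) = 0 := ZMod.natCast_self _
  push_cast at this
  linear_combination (t : ZMod (r ^ 2 * t)) * this

theorem sum_orbit_eq {q r t m : ℕ} [NeZero q] (hq : q = r ^ 2 * t) {a : Fin m → ℤ}
    (ha : HereditarilyGoodMod r a) {x : ℂ} (hx : x ^ q ≠ 1) (y : ℂ) (k : ZMod q) :
    ∑ c : ZMod q, ∏ i, hodgeFactor x y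
        (ZMod.stdAddChar (k * (1 + (r * t : ZMod q) * c) * ((r * t * a i + 1 : ℤ) : ZMod q))) =
      ∑ c : ZMod q, ∏ i, hodgeFactor x y
        (ZMod.stdAddChar (k * (1 + (r * t : ZMod q) * c) * ((-(r * t) * a i + 1 : ℤ) : ZMod q))) := by
  have hr : 0 < r := Nat.pos_of_ne_zero fun h => NeZero.ne q (by simp [hq, h])
  set W : AddChar (ZMod q) ℂ := ZMod.stdAddChar
  have hrt : (r * t : ZMod q) ^ 2 = 0 := by
    subst hq
    exact ZMod.natCast_mul_sq_eq_zero r t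
  set η := W (k * (r * t)) with hη
  have hηr : η ^ r = 1 := by
    rw [hη, ← W.map_nsmul_eq_pow, nsmul_eq_mul]
    have : ((r ^ 2 * t : ℕ) : ZMod q) = 0 := hq ▸ ZMod.natCast_self q
    push_cast at this
    rw [show (r : ZMod q) * (k * (r * t)) = 0 by linear_combination k * this, W.map_zero_eq_one]
  set d := orderOf η with hd
  have hdr : d ∣ r := orderOf_dvd_of_pow_eq_one hηr
  have hdq : d ∣ q := hdr.trans ⟨r * t, by rw [hq]; ring⟩
  have hd0 : 0 < d := Nat.pos_of_dvd_of_pos hdr hr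
  have : NeZero d := ⟨hd0.ne'⟩
  have hprim : IsPrimitiveRoot η d := IsPrimitiveRoot.orderOf η
  set e : AddChar (ZMod d) ℂ := AddChar.zmodChar d hprim.pow_eq_one
  have he1 : e 1 = η := by
    have := AddChar.zmodChar_apply' hprim.pow_eq_one 1
    simpa using this
  have he (c : ZMod q) : W (k * (r * t) * c) = e (ZMod.castHom hdq (ZMod d) c) := by
    obtain ⟨n, rfl⟩ := ZMod.intCast_surjective c
    rw [map_intCast, ← zsmul_one (R := ZMod d), e.map_zsmul_eq_zpow, he1, hη, ← W.map_zsmul_eq_zpow,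
      zsmul_eq_mul, mul_comm]
  have hWq (j : ZMod q) : W j ^ q = 1 := by
    rw [← W.map_nsmul_eq_pow]
    simp
  have hu : W k ≠ 0 := fun h => by simpa [h, NeZero.ne q] using hWq k
  have hz (j : ZMod d) : (W k * e j) ^ q = 1 := by
    obtain ⟨c, rfl⟩ := ZMod.castHom_surjective hdq j
    rw [← he, ← W.map_add_eq_mul, hWq]
  have h1 (c : ZMod q) (i) : W (k * (1 + r * t * c) * ((r * t * a i + 1 : ℤ) : ZMod q)) =
      W k * e (ZMod.castHom hdq (ZMod d) c + a i) := by
    rw [← map_intCast (ZMod.castHom hdq (ZMod d)), ← map_add, ← he, ← W.map_add_eq_mul]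
    push_cast
    congr 1
    linear_combination (k * c * a i) * hrt
  have h2 (c : ZMod q) (i) : W (k * (1 + r * t * c) * ((-(r * t) * a i + 1 : ℤ) : ZMod q)) =
      W k * e (ZMod.castHom hdq (ZMod d) c - a i) := by
    rw [← map_intCast (ZMod.castHom hdq (ZMod d)), ← map_sub, ← he, ← W.map_add_eq_mul]
    push_cast
    congr 1
    linear_combination (-k * c * a i) * hrt
  simp_rw [h1, h2]
  refine sum_comp_eq_sum_comp_of_surjective (ZMod.castHom hdq (ZMod d)).toAddMonoidHom
    (ZMod.castHom_surjective hdq) (F := fun b => ∏ i, hodgeFactor x y (W k * e (b + a i)))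
    (F' := fun b => ∏ i, hodgeFactor x y (W k * e (b - a i))) ?_
  rcases ha d hd0 hdr with hinj | hrev
  · refine e.sum_prod_add_eq_sum_prod_sub_of_injective (he1 ▸ hprim) hinj hu ?_ ?_ y
    · rintro j rfl
      exact hx (hz j)
    · rintro j rfl
      exact hx (by rw [inv_pow, hz, inv_one])
  · exact sum_prod_add_eq_sum_prod_sub_of_reversible hrev
      fun b => hodgeFactor x y (W k * e b)

theorem card_mul_sum_eq_sum_sum {R : Type*} [CommRing R] [Fintype R] {s : R} (hs : s ^ 2 = 0)
    (T : R → ℂ) :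
    (Fintype.card R : ℂ) * ∑ k, T k = ∑ k, ∑ c, T (k * (1 + s * c)) := by
  rw [Finset.sum_comm, ← nsmul_eq_mul, ← Finset.card_univ, ← Finset.sum_const]
  refine Finset.sum_congr rfl fun c _ => ?_
  have h : (1 + s * c) * (1 - s * c) = 1 := by linear_combination (-c ^ 2) * hs
  exact (Equiv.sum_comp (Units.mulRight ⟨1 + s * c, 1 - s * c, h, by rw [mul_comm, h]⟩) T).symm

/-- If `a` is hereditarily good mod `r`, then `LMR(r,t,a)` and `LMR(r,t,-a)` are
Hodge-equivalent: their Hodge series sums agree. -/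
theorem lmr_hodge_equivalence (r t m : ℕ) (hr : 2 < r) (ht : 1 ≤ t) (hm : 1 ≤ m)
    (a : Fin m → ℤ) (ha : HereditarilyGoodMod r a) :
    ∀ x y : ℂ, x ^ (r ^ 2 * t) ≠ 1 →
      hodgeSum (r ^ 2 * t) (fun i => (r : ℤ) * t * a i + 1) x y
        = hodgeSum (r ^ 2 * t) (fun i => -((r : ℤ) * t) * a i + 1) x y := by
  intro x y hx
  have : NeZero (r ^ 2 * t) := ⟨by positivity⟩
  have hrt := ZMod.natCast_mul_sq_eq_zero r t
  have hcard : (Fintype.card (ZMod (r ^ 2 * t)) : ℂ) ≠ 0 :=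
    Nat.cast_ne_zero.2 Fintype.card_ne_zero
  rw [hodgeSum_eq_sum_stdAddChar, hodgeSum_eq_sum_stdAddChar]
  apply mul_left_cancel₀ hcard
  rw [card_mul_sum_eq_sum_sum hrt, card_mul_sum_eq_sum_sum hrt]
  exact Finset.sum_congr rfl fun k _ => sum_orbit_eq rfl ha hx y k
end

section
/- Let $K$ be a field, $m \geq 1$, and let $x_1,\ldots,x_m \in K$ be nonzero, and $u, v \in K$. Suppose that for all $i \neq j$: $x_i \neq x_j$ and $x_j \neq x_i v$. Then $$\sum_{i=1}^m \prod_{j \neq i} \frac{(x_i u - x_j)(x_j u - x_i v)}{(x_i - x_j)(x_j - x_i v)} = \sum_{i=1}^m \prod_{j \neq i} \frac{(x_j u - x_i)(x_i u - x_j v)}{(x_j - x_i)(x_i - x_j v)},$$ i.e., the rational function $F((x_1,\ldots,x_m),u,v) = \sum_{i=1}^m \prod_{j \neq i} \frac{(u - x_j/x_i)(u - (x_i/x_j)v)}{(1 - x_j/x_i)(1 - (x_i/x_j)v)}$ is unchanged when the variables $x_1,\ldots,x_m$ are replaced by their reciprocals: $F((x_1,\ldots,x_m),u,v) = F((1/x_1,\ldots,1/x_m),u,v)$.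 -/
open Polynomial in
/-- The residue theorem for `∏ k, (a k * z + b k) / (z - y k) * dz / z` on the projective line. -/
theorem sum_residue_prod_linear_div {K ι : Type*} [Field K] [Fintype ι] [DecidableEq ι]
    (y a b : ι → K) (hy : Function.Injective y) (hy0 : ∀ k, y k ≠ 0) :
    ∑ k, (a k * y k + b k) / y k *
        ∏ l ∈ Finset.univ.erase k, (a l * y k + b l) / (y k - y l)
      = ∏ k, a k - ∏ k, b k / (-y k) := by
  set P : K[X] := ∏ k, (C (a k) * X + C (b k)) with hP
  have hdeg : P.natDegree ≤ Fintype.card ι := by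
    refine (natDegree_prod_le _ _).trans ?_
    refine (Finset.sum_le_sum fun k _ => natDegree_linear_le).trans ?_
    simp
  have hcoeff : P.coeff (Fintype.card ι) = ∏ k, a k := by
    have := coeff_prod_of_natDegree_le (s := (Finset.univ : Finset ι))
      (fun k => C (a k) * X + C (b k)) 1 (fun k _ => natDegree_linear_le)
    simpa [Finset.card_univ] using this
  have hinj : Set.InjOn (fun o : Option ι => o.elim 0 y) (Finset.univ : Finset (Option ι)) := by
    rintro (_ | i) _ (_ | j) _ h
    · rfl
    · exact absurd h.symm (hy0 j)
    · exact absurd h (hy0 i)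
    · exact congrArg some (hy h)
  have hlt : P.degree < (Finset.univ : Finset (Option ι)).card := by
    refine (natDegree_le_iff_degree_le.mp hdeg).trans_lt ?_
    simp only [Finset.card_univ, Fintype.card_option]
    exact_mod_cast Nat.lt_succ_self _
  have key := Lagrange.coeff_eq_sum hinj hlt
  have hnone : (Finset.univ : Finset (Option ι)).erase none = Finset.univ.map .some := by
    ext (_ | i) <;> simp
  have hsome (k : ι) : (Finset.univ : Finset (Option ι)).erase (some k)
      = Finset.insertNone (Finset.univ.erase k) := by
    ext (_ | i) <;> simp
  rw [Finset.card_univ, Fintype.card_option, Nat.add_sub_cancel, hcoeff,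
    Fintype.sum_option, hnone, Finset.prod_map] at key
  rw [key]
  simp only [Option.elim, Function.Embedding.some_apply, zero_sub, hsome,
    Finset.prod_insertNone, sub_zero, hP, eval_prod, eval_add, eval_mul, eval_C, eval_X,
    mul_zero, zero_add, Finset.prod_div_distrib]
  rw [add_sub_cancel_left]
  refine Finset.sum_congr rfl fun k _ => ?_
  rw [← Finset.mul_prod_erase Finset.univ (fun l => a l * y k + b l) (Finset.mem_univ k),
    div_mul_div_comm]

/-- Both sums in the case `v = 0` equal `(u ^ m - 1) / (u - 1)`. -/
theorem sum_prod_div_sub_eq_reverse {K ι : Type*} [Field K] [Fintype ι] [DecidableEq ι]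
    (x : ι → K) (hx : Function.Injective x) (hx0 : ∀ i, x i ≠ 0) (u : K) (hu : u ≠ 1) :
    ∑ i, ∏ j ∈ Finset.univ.erase i, (x i * u - x j) / (x i - x j)
      = ∑ i, ∏ j ∈ Finset.univ.erase i, (x j * u - x i) / (x j - x i) := by
  have h₁ := sum_residue_prod_linear_div x (fun _ => u) (fun j => -x j) hx hx0
  have h₂ := sum_residue_prod_linear_div x (fun _ => 1) (fun j => -(x j * u)) hx hx0
  have e₁ (i : ι) : (u * x i + -x i) / x i = u - 1 := by
    have := hx0 i
    field_simp
    ring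
  have e₂ (i : ι) : (1 * x i + -(x i * u)) / x i = -(u - 1) := by
    have := hx0 i
    field_simp
    ring
  have e₃ (i : ι) : -x i / -x i = 1 := div_self (neg_ne_zero.mpr (hx0 i))
  have e₄ (i : ι) : -(x i * u) / -x i = u := by
    have := hx0 i
    field_simp
  simp only [e₁, e₂, e₃, e₄, ← Finset.mul_sum, Finset.prod_const_one] at h₁ h₂
  refine mul_left_cancel₀ (sub_ne_zero.mpr hu) ?_
  have l₁ : ∑ i, ∏ j ∈ Finset.univ.erase i, (x i * u - x j) / (x i - x j)
      = ∑ i, ∏ j ∈ Finset.univ.erase i, (u * x i + -x j) / (x i - x j) := by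
    refine Finset.sum_congr rfl fun i _ => Finset.prod_congr rfl fun j _ => ?_
    ring
  have l₂ : ∑ i, ∏ j ∈ Finset.univ.erase i, (x j * u - x i) / (x j - x i)
      = ∑ i, ∏ j ∈ Finset.univ.erase i, (1 * x i + -(x j * u)) / (x i - x j) := by
    refine Finset.sum_congr rfl fun i _ => Finset.prod_congr rfl fun j _ => ?_
    rw [← neg_div_neg_eq]
    ring
  rw [l₁, l₂]
  linear_combination h₁ + h₂

/-- The main identity away from the degenerate parameter values. -/
theorem sum_prod_eq_reverse_of_generic {K ι : Type*} [Field K] [Fintype ι] [DecidableEq ι]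
    (x : ι → K) (hx : Function.Injective x) (hx0 : ∀ i, x i ≠ 0) (u v : K)
    (hxv : ∀ i j, x j ≠ x i * v) (hu : u ≠ 1) (huv : u ≠ v) (hv0 : v ≠ 0) (hv1 : v ≠ 1) :
    ∑ i, ∏ j ∈ Finset.univ.erase i,
        ((x i * u - x j) * (x j * u - x i * v)) / ((x i - x j) * (x j - x i * v))
      = ∑ i, ∏ j ∈ Finset.univ.erase i,
        ((x j * u - x i) * (x i * u - x j * v)) / ((x j - x i) * (x i - x j * v)) := by
  have hv1' : 1 - v ≠ 0 := sub_ne_zero.mpr hv1.symm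
  have hv1'' : v - 1 ≠ 0 := sub_ne_zero.mpr hv1
  have hinj : Function.Injective (Sum.elim x fun j => x j / v) := by
    refine hx.sumElim (fun i j h => hx ((div_left_inj' hv0).mp h)) fun i j h => ?_
    exact hxv i j (by rw [h]; field_simp)
  have hne0 : ∀ k, Sum.elim x (fun j => x j / v) k ≠ 0 := by
    rintro (i | i)
    · exact hx0 i
    · exact div_ne_zero (hx0 i) hv0
  have key := sum_residue_prod_linear_div (Sum.elim x fun j => x j / v)
    (Sum.elim (fun _ => u) fun _ => 1) (Sum.elim (fun j => -x j) fun j => -(x j * u / v))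
    hinj hne0
  have hl (i : ι) : (Finset.univ : Finset (ι ⊕ ι)).erase (.inl i)
      = (Finset.univ.erase i).disjSum Finset.univ := by
    ext (j | j) <;> simp
  have hr (i : ι) : (Finset.univ : Finset (ι ⊕ ι)).erase (.inr i)
      = Finset.univ.disjSum (Finset.univ.erase i) := by
    ext (j | j) <;> simp
  have e₃ (i : ι) : -x i / -x i = 1 := div_self (neg_ne_zero.mpr (hx0 i))
  have e₄ (i : ι) : -(x i * u / v) / -(x i / v) = u := by
    have := hx0 i
    field_simp
  simp only [Fintype.sum_sum_type, Fintype.prod_sum_type, hl, hr, Finset.prod_disjSum,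
    Sum.elim_inl, Sum.elim_inr, e₃, e₄, Finset.prod_const_one, mul_one, one_mul, sub_self] at key
  have hC : (u - 1) * (u - v) / (1 - v) ≠ 0 :=
    div_ne_zero (mul_ne_zero (sub_ne_zero.mpr hu) (sub_ne_zero.mpr huv)) hv1'
  refine mul_left_cancel₀ hC (sub_eq_zero.mp ?_)
  rw [← key, sub_eq_add_neg, ← neg_mul, Finset.mul_sum, Finset.mul_sum]
  congr 1
  · refine Finset.sum_congr rfl fun i _ => ?_
    rw [← Finset.mul_prod_erase Finset.univ _ (Finset.mem_univ i),
      mul_left_comm (∏ j ∈ Finset.univ.erase i, _), ← Finset.prod_mul_distrib, ← mul_assoc]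
    have := hx0 i
    congr 1
    · have : x i - x i / v ≠ 0 := by
        rw [show x i - x i / v = x i * (v - 1) / v by field_simp]
        positivity
      field_simp
      ring
    · refine Finset.prod_congr rfl fun j hj => ?_
      have h₁ : x i - x j ≠ 0 := sub_ne_zero.mpr (hx.ne (Finset.ne_of_mem_erase hj).symm)
      have h₂ : x j - x i * v ≠ 0 := sub_ne_zero.mpr (hxv i j)
      have e : (x i + -(x j * u / v)) / (x i - x j / v)
          = (x j * u - x i * v) / (x j - x i * v) := by
        have h₃ : x i - x j / v ≠ 0 := by
          rw [show x i - x j / v = -(x j - x i * v) / v by field_simp; ring]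
          exact div_ne_zero (neg_ne_zero.mpr h₂) hv0
        rw [div_eq_div_iff h₃ h₂]
        field_simp
        ring
      rw [e, div_mul_div_comm]
      ring
  · refine Finset.sum_congr rfl fun i _ => ?_
    rw [← Finset.mul_prod_erase Finset.univ _ (Finset.mem_univ i),
      mul_assoc, ← Finset.prod_mul_distrib, ← mul_assoc]
    have := hx0 i
    congr 1
    · have h₃ : x i / v - x i ≠ 0 := by
        rw [show x i / v - x i = x i * (1 - v) / v by field_simp]
        positivity
      field_simp
      ring
    · refine Finset.prod_congr rfl fun j hj => ?_
      have h₁ : x i - x j ≠ 0 := sub_ne_zero.mpr (hx.ne (Finset.ne_of_mem_erase hj).symm)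
      have h₂ : x i - x j * v ≠ 0 := sub_ne_zero.mpr (hxv j i)
      have e₁ : (u * (x i / v) + -x j) / (x i / v - x j)
          = (x i * u - x j * v) / (x i - x j * v) := by
        rw [show x i / v - x j = (x i - x j * v) / v by field_simp,
          show u * (x i / v) + -x j = (x i * u - x j * v) / v by field_simp; ring,
          div_div_div_cancel_right₀ hv0]
      have e₂ : (x i / v + -(x j * u / v)) / (x i / v - x j / v)
          = (x j * u - x i) / (x j - x i) := by
        rw [← sub_div, ← neg_div, ← add_div, div_div_div_cancel_right₀ hv0, ← neg_div_neg_eq]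
        ring
      rw [e₁, e₂, div_mul_div_comm]
      ring

/-- The main identity: the rational function
`F((x₁,…,x_m),u,v) = ∑ i, ∏_{j ≠ i} ((xᵢu - xⱼ)(xⱼu - xᵢv)) / ((xᵢ - xⱼ)(xⱼ - xᵢv))`
is unchanged when the variables `x₁,…,x_m` are replaced by their reciprocals. -/
theorem main_identity {K : Type*} [Field K] (m : ℕ) (hm : 1 ≤ m)
    (x : Fin m → K) (hx0 : ∀ i, x i ≠ 0) (u v : K)
    (hne : ∀ i j : Fin m, i ≠ j → x i ≠ x j ∧ x j ≠ x i * v) :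
    ∑ i : Fin m, ∏ j ∈ Finset.univ.erase i,
        ((x i * u - x j) * (x j * u - x i * v)) / ((x i - x j) * (x j - x i * v))
      = ∑ i : Fin m, ∏ j ∈ Finset.univ.erase i,
        ((x j * u - x i) * (x i * u - x j * v)) / ((x j - x i) * (x i - x j * v)) := by
  have hx : Function.Injective x := fun i j h => by_contra fun hij => (hne i j hij).1 h
  by_cases hv1 : v = 1
  · refine Finset.sum_congr rfl fun i _ => Finset.prod_congr rfl fun j _ => ?_
    subst hv1
    congr 1 <;> ring
  by_cases hu : u = 1
  · subst hu
    have h (i j : Fin m) (hij : i ≠ j) :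
        (x i * 1 - x j) * (x j * 1 - x i * v) / ((x i - x j) * (x j - x i * v)) = 1 := by
      rw [mul_one, mul_one]
      exact div_self (mul_ne_zero (sub_ne_zero.mpr (hne i j hij).1)
        (sub_ne_zero.mpr (hne i j hij).2))
    refine Finset.sum_congr rfl fun i _ => Finset.prod_congr rfl fun j hj => ?_
    have hji := Finset.ne_of_mem_erase hj
    rw [h i j hji.symm, h j i hji]
  by_cases huv : u = v
  · subst huv
    have h (i j : Fin m) (hij : i ≠ j) :
        (x i * u - x j) * (x j * u - x i * u) / ((x i - x j) * (x j - x i * u)) = u := by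
      have h₁ := sub_ne_zero.mpr (hne i j hij).1
      have h₂ := sub_ne_zero.mpr (hne i j hij).2
      rw [div_eq_iff (mul_ne_zero h₁ h₂)]
      ring
    refine Finset.sum_congr rfl fun i _ => Finset.prod_congr rfl fun j hj => ?_
    have hji := Finset.ne_of_mem_erase hj
    rw [h i j hji.symm, h j i hji]
  by_cases hv0 : v = 0
  · subst hv0
    have h (i j : Fin m) :
        (x i * u - x j) * (x j * u - x i * 0) / ((x i - x j) * (x j - x i * 0))
          = u * ((x i * u - x j) / (x i - x j)) := by
      rw [mul_zero, sub_zero, sub_zero, mul_div_mul_comm, mul_div_cancel_left₀ _ (hx0 j), mul_comm]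
    simp only [h, Finset.prod_mul_distrib, Finset.prod_const,
      Finset.card_erase_of_mem (Finset.mem_univ _), ← Finset.mul_sum]
    rw [sum_prod_div_sub_eq_reverse x hx hx0 u hu]
  refine sum_prod_eq_reverse_of_generic x hx hx0 u v (fun i j => ?_) hu huv hv0 hv1
  rcases eq_or_ne i j with rfl | hij
  · exact fun h => hv1 (mul_left_cancel₀ (hx0 i) (by rw [← h, mul_one]))
  · exact (hne i j hij).2
end

section
/- Let $K$ be a field, $m \geq 0$, $u \in K$, and let $x_1,\ldots,x_m \in K$ be pairwise distinct. Then $$\sum_{i=1}^m \prod_{j \neq i} \frac{x_i u - x_j}{x_i - x_j} = 1 + u + u^2 + \cdots + u^{m-1}.$$ -/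
open Polynomial in
/-- There is a polynomial of degree less than `#s`, with coefficient `1 + u + ⋯ + u ^ (#s - 1)` in
degree `#s - 1`, taking the value `∏_{j ≠ i} (u xᵢ - xⱼ)` at each node `xᵢ`. Its product with
`(u - 1) X` is `∏ (u X - xⱼ) - ∏ (X - xⱼ)`. -/
theorem exists_polynomial_eval_eq_prod_erase {R ι : Type*} [CommRing R] [Nontrivial R]
    [DecidableEq ι] (u : R) (x : ι → R) (s : Finset ι) :
    ∃ F : R[X], F.degree < s.card ∧ (F * X).coeff s.card = ∑ k ∈ Finset.range s.card, u ^ k ∧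
      (∀ y, F.eval y * ((u - 1) * y) + ∏ j ∈ s, (y - x j) = ∏ j ∈ s, (y * u - x j)) ∧
      ∀ i ∈ s, F.eval (x i) = ∏ j ∈ s.erase i, (x i * u - x j) := by
  induction s using Finset.induction_on with
  | empty => exact ⟨0, by simp⟩
  | insert a s ha ih =>
    obtain ⟨F, hdeg, hcoeff, hdiff, heval⟩ := ih
    refine ⟨F * (C u * X - C (x a)) + Lagrange.nodal s x, ?_, ?_, fun y => ?_, fun i hi => ?_⟩
    · rw [Finset.card_insert_of_notMem ha, degree_lt_iff_coeff_zero]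
      intro n hn
      obtain ⟨n, rfl⟩ : ∃ k, n = k + 1 := ⟨n - 1, by omega⟩
      have hF := (degree_lt_iff_coeff_zero F _).1 hdeg
      have hN : (Lagrange.nodal s x).coeff (n + 1) = 0 :=
        coeff_eq_zero_of_natDegree_lt (by rw [Lagrange.natDegree_nodal]; omega)
      rw [show F * (C u * X - C (x a)) = C u * (F * X) - C (x a) * F by ring]
      simp [hN, hF n (by omega), hF (n + 1) (by omega)]
    · have hF : F.coeff s.card = 0 := (degree_lt_iff_coeff_zero F _).1 hdeg _ le_rfl
      have hN : (Lagrange.nodal s x).coeff s.card = 1 := by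
        have h := Lagrange.nodal_monic (s := s) (v := x)
        rwa [Monic, leadingCoeff, Lagrange.natDegree_nodal] at h
      rw [Finset.card_insert_of_notMem ha, coeff_mul_X,
        show F * (C u * X - C (x a)) = C u * (F * X) - C (x a) * F by ring, coeff_add, coeff_sub,
        coeff_C_mul, coeff_C_mul, hcoeff, hF, hN, geom_sum_succ]
      ring
    · rw [Finset.prod_insert ha, Finset.prod_insert ha, ← hdiff y]
      simp only [eval_add, eval_mul, eval_sub, eval_C, eval_X, Lagrange.eval_nodal]
      ring
    · simp only [eval_add, eval_mul, eval_sub, eval_C, eval_X, Lagrange.eval_nodal]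
      rcases Finset.mem_insert.1 hi with rfl | his
      · rw [Finset.erase_insert ha, ← hdiff]
        ring
      · have hne : a ≠ i := fun h => ha (h ▸ his)
        rw [Finset.prod_eq_zero his (sub_self _), heval i his, Finset.erase_insert_of_ne hne,
          Finset.prod_insert (fun h => ha (Finset.mem_of_mem_erase h))]
        ring

/-- The subsidiary identity: `∑ i, ∏_{j ≠ i} (xᵢ u - xⱼ)/(xᵢ - xⱼ) = 1 + u + ⋯ + u^{m-1}`
for pairwise distinct `x₁, …, x_m`. -/
theorem subsidiary_identity {K : Type*} [Field K] (m : ℕ) (u : K) (x : Fin m → K)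
    (hx : ∀ i j : Fin m, i ≠ j → x i ≠ x j) :
    ∑ i : Fin m, ∏ j ∈ Finset.univ.erase i, (x i * u - x j) / (x i - x j)
      = ∑ k ∈ Finset.range m, u ^ k := by
  cases m with
  | zero => simp
  | succ n =>
    obtain ⟨F, hdeg, hcoeff, -, heval⟩ := exists_polynomial_eval_eq_prod_erase u x Finset.univ
    have hinj : Set.InjOn x (Finset.univ : Finset (Fin (n + 1))) :=
      fun i _ j _ h => by_contra fun hij => hx i j hij h
    have hsum := Lagrange.coeff_eq_sum hinj hdeg
    rw [Finset.card_fin, Nat.add_sub_cancel] at hsum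
    rw [Finset.card_fin, Polynomial.coeff_mul_X, hsum] at hcoeff
    rw [← hcoeff]
    exact Finset.sum_congr rfl fun i hi => by rw [Finset.prod_div_distrib, heval i hi]
end

section
/- Let $r, t \geq 1$ be integers, let $d \geq 1$ divide $r^2 t$, set $d' = d/\gcd(d, rt)$, and let $a = (a_1,\ldots,a_m) \in \mathbb{Z}^m$. Suppose there exists $c \in \mathbb{Z}$ such that the multiset of residues $\{(a_i + c) \bmod d'\}$ equals the multiset $\{(-a_i) \bmod d'\}$. Then $e = rt\,c + 1$ is a unit mod $d$, and the multiset of residues mod $d$ of $\{e \cdot (rt\,a_i + 1),\; e \cdot (-(rt\,a_i + 1)) : 1 \le i \le m\}$ equals the multiset of residues mod $d$ of $\{-rt\,a_i + 1,\; -(-rt\,a_i + 1) : 1 \le i \le m\}$. -/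
/-- Multiplication by `k` on integers descends to a map from `ZMod (d / gcd d k)` to `ZMod d`. -/
theorem exists_zmod_div_gcd_mul (d k : ℕ) :
    ∃ f : ZMod (d / Nat.gcd d k) → ZMod d, ∀ x : ℤ, f (x : ZMod (d / Nat.gcd d k)) = k * x := by
  have hk : ((k : ZMod d)) * ((d / Nat.gcd d k : ℕ) : ZMod d) = 0 := by
    rw [← Nat.cast_mul, ZMod.natCast_eq_zero_iff, ← Nat.mul_div_assoc _ (Nat.gcd_dvd_left d k),
      mul_comm, Nat.mul_div_assoc _ (Nat.gcd_dvd_right d k)]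
    exact dvd_mul_right _ _
  refine ⟨ZMod.lift _ ⟨(AddMonoidHom.mulLeft (k : ZMod d)).comp (Int.castAddHom (ZMod d)), ?_⟩,
    fun x => ?_⟩
  · simpa [-Int.natCast_ediv, -Nat.cast_div] using hk
  · simp

/-- If `a` is reversible mod `d' = d / gcd(d, rt)` (with `d ∣ r²t`), witnessed by `c`,
then `e = rtc + 1` is a unit mod `d`, and the doubled list `(rta+1, -(rta+1))`
multiplied by `e` agrees, as a multiset mod `d`, with the doubled list
`(-rta+1, -(-rta+1))`. -/
theorem reversibility_transfer (r t d : ℕ) (hr : 1 ≤ r) (ht : 1 ≤ t) (hd : 1 ≤ d)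
    (hdvd : d ∣ r ^ 2 * t) (m : ℕ) (a : Fin m → ℤ) (c : ℤ)
    (hrev : Multiset.map (fun i : Fin m => ((a i + c : ℤ) : ZMod (d / Nat.gcd d (r * t))))
        Finset.univ.val
      = Multiset.map (fun i : Fin m => ((-a i : ℤ) : ZMod (d / Nat.gcd d (r * t))))
        Finset.univ.val) :
    IsUnit ((((r : ℤ) * t * c + 1 : ℤ) : ZMod d)) ∧
    (Multiset.map (fun i : Fin m =>
        (((r : ℤ) * t * c + 1 : ℤ) : ZMod d) * (((r : ℤ) * t * a i + 1 : ℤ) : ZMod d))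
        Finset.univ.val
      + Multiset.map (fun i : Fin m =>
        (((r : ℤ) * t * c + 1 : ℤ) : ZMod d) * ((-((r : ℤ) * t * a i + 1) : ℤ) : ZMod d))
        Finset.univ.val)
    = (Multiset.map (fun i : Fin m => ((-(r : ℤ) * t * a i + 1 : ℤ) : ZMod d))
        Finset.univ.val
      + Multiset.map (fun i : Fin m => ((-(-(r : ℤ) * t * a i + 1) : ℤ) : ZMod d))
        Finset.univ.val) := by
  have hsq : ((r : ZMod d) * t) * ((r : ZMod d) * t) = 0 := by
    have h : ((r ^ 2 * t : ℕ) : ZMod d) = 0 := (ZMod.natCast_eq_zero_iff _ _).2 hdvd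
    push_cast at h
    linear_combination (t : ZMod d) * h
  obtain ⟨f, hf⟩ := exists_zmod_div_gcd_mul d (r * t)
  have key : Multiset.map (fun i : Fin m =>
        (((r : ℤ) * t * c + 1 : ℤ) : ZMod d) * (((r : ℤ) * t * a i + 1 : ℤ) : ZMod d))
        Finset.univ.val
      = Multiset.map (fun i : Fin m => ((-(r : ℤ) * t * a i + 1 : ℤ) : ZMod d))
        Finset.univ.val := by
    have h := congrArg (Multiset.map fun x => f x + 1) hrev
    simp only [Multiset.map_map, Function.comp_def, hf] at h
    convert h using 3 with i _ i
    · push_cast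
      linear_combination (c : ZMod d) * (a i : ZMod d) * hsq
    · push_cast
      ring
  refine ⟨IsUnit.of_mul_eq_one (1 - (r : ZMod d) * t * c) ?_, congrArg₂ (· + ·) key ?_⟩
  · push_cast
    linear_combination -(c : ZMod d) ^ 2 * hsq
  · simpa only [Multiset.map_map, Function.comp_def, Int.cast_neg, mul_neg]
      using congrArg (Multiset.map Neg.neg) key
end
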